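/- For every d ≥ 2 and every x ∈ ℤ^d, the expected mass with homogeneous initial condition satisfies lim_{t→∞} m_x(t) = 1. -/

import Mathlib

open Filter Topology BoundedContinuousFunction MeasureTheory

/-- The normalised Lebesgue measure on `[-π, π]`. -/
noncomputable def circleMeasure : Measure ℝ :=
  (2 * ENNReal.ofReal Real.pi)⁻¹ • volume.restrict (Set.Icc (-Real.pi) Real.pi)

instance : IsProbabilityMeasure circleMeasure := by
  constructor
  have h : ENNReal.ofReal (Real.pi - -Real.pi) = 2 * ENNReal.ofReal Real.pi := by
    rw [show Real.pi - -Real.pi = 2 * Real.pi by ring, ENNReal.ofReal_mul (by norm_num)]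
    norm_num
  have h0 : (2 * ENNReal.ofReal Real.pi) ≠ 0 := by simp [Real.pi_pos]
  simp only [circleMeasure, Measure.smul_apply, Measure.restrict_apply_univ, Real.volume_Icc, h,
    smul_eq_mul]
  exact ENNReal.inv_mul_cancel h0 (ENNReal.mul_ne_top (by norm_num) ENNReal.ofReal_ne_top)

lemma integral_circleMeasure (f : ℝ → ℝ) :
    ∫ θ, f θ ∂circleMeasure = (2 * Real.pi)⁻¹ * ∫ θ in Set.Icc (-Real.pi) Real.pi, f θ := by
  rw [circleMeasure, integral_smul_measure]
  simp [ENNReal.toReal_ofReal Real.pi_pos.le, mul_comm]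

lemma integral_cos_int_mul_circleMeasure (n : ℤ) :
    ∫ θ, Real.cos (n * θ) ∂circleMeasure = if n = 0 then 1 else 0 := by
  split_ifs with h
  · simp [h]
  · have hn : (n : ℝ) ≠ 0 := by exact_mod_cast h
    rw [integral_circleMeasure, integral_Icc_eq_integral_Ioc,
      ← intervalIntegral.integral_of_le (by linarith [Real.pi_pos]),
      intervalIntegral.integral_comp_mul_left (fun u => Real.cos u) hn, integral_cos,
      show (n : ℝ) * -Real.pi = -(n * Real.pi) by ring, Real.sin_neg, Real.sin_int_mul_pi]
    simp

/-- The return probability at time `s` of a rate two continuous-time simple random walk on `ℤ`. -/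
noncomputable def returnProb (s : ℝ) : ℝ :=
  ∫ θ, Real.exp (-(s * (2 * (1 - Real.cos θ)))) ∂circleMeasure

lemma returnProb_integrand_le_one {s : ℝ} (hs : 0 ≤ s) (θ : ℝ) :
    Real.exp (-(s * (2 * (1 - Real.cos θ)))) ≤ 1 := by
  rw [Real.exp_le_one_iff, neg_nonpos]
  exact mul_nonneg hs (by linarith [Real.cos_le_one θ])

lemma integrable_returnProb_integrand {s : ℝ} (hs : 0 ≤ s) :
    Integrable (fun θ => Real.exp (-(s * (2 * (1 - Real.cos θ))))) circleMeasure := by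
  refine Integrable.of_bound (C := 1) (by fun_prop) (.of_forall fun θ => ?_)
  rw [Real.norm_eq_abs, abs_of_pos (Real.exp_pos _)]
  exact returnProb_integrand_le_one hs θ

lemma returnProb_nonneg (s : ℝ) : 0 ≤ returnProb s :=
  integral_nonneg fun _ => (Real.exp_pos _).le

lemma returnProb_le_one {s : ℝ} (hs : 0 ≤ s) : returnProb s ≤ 1 := by
  calc returnProb s ≤ ∫ _, (1 : ℝ) ∂circleMeasure :=
        integral_mono (integrable_returnProb_integrand hs) (integrable_const _)
          fun θ => returnProb_integrand_le_one hs θ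
    _ = 1 := by simp

lemma exists_sqrt_mul_returnProb_le : ∃ C : ℝ, 0 < C ∧ ∀ s : ℝ, 0 < s → √s * returnProb s ≤ C := by
  refine ⟨(2 * Real.pi)⁻¹ * √(Real.pi / (4 / Real.pi ^ 2)), by positivity, fun s hs => ?_⟩
  have hb : 0 < s * (4 / Real.pi ^ 2) := by positivity
  have hle : ∫ θ in Set.Icc (-Real.pi) Real.pi, Real.exp (-(s * (2 * (1 - Real.cos θ))))
      ≤ √(Real.pi / (s * (4 / Real.pi ^ 2))) := by
    rw [← integral_gaussian]
    refine (setIntegral_mono_on (Continuous.integrableOn_Icc (by fun_prop))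
      (integrable_exp_neg_mul_sq hb).integrableOn measurableSet_Icc fun θ hθ => ?_).trans
      (setIntegral_le_integral (integrable_exp_neg_mul_sq hb)
        (.of_forall fun _ => (Real.exp_pos _).le))
    rw [Real.exp_le_exp]
    have h1 : Real.cos θ ≤ 1 - 2 / Real.pi ^ 2 * θ ^ 2 :=
      Real.cos_le_one_sub_mul_cos_sq (abs_le.2 hθ)
    have h2 := mul_le_mul_of_nonneg_left h1 hs.le
    have h3 : s * (4 / Real.pi ^ 2) * θ ^ 2 = 2 * (s * (2 / Real.pi ^ 2 * θ ^ 2)) := by ring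
    nlinarith
  have hsq : √(Real.pi / (s * (4 / Real.pi ^ 2))) = √(Real.pi / (4 / Real.pi ^ 2)) / √s := by
    rw [← Real.sqrt_div (by positivity)]
    congr 1
    field_simp
  rw [returnProb, integral_circleMeasure, mul_left_comm]
  refine mul_le_mul_of_nonneg_left ?_ (by positivity)
  calc √s * _ ≤ √s * (√(Real.pi / (4 / Real.pi ^ 2)) / √s) :=
        mul_le_mul_of_nonneg_left (hle.trans hsq.le) (Real.sqrt_nonneg s)
    _ = _ := mul_div_cancel₀ _ (Real.sqrt_pos.2 hs).ne'

lemma exists_le_sqrt_mul_returnProb : ∃ c : ℝ, 0 < c ∧ ∀ s : ℝ, 1 ≤ s → c ≤ √s * returnProb s := by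
  refine ⟨(2 * Real.pi)⁻¹ * Real.exp (-1), by positivity, fun s hs => ?_⟩
  have hs0 : 0 < √s := Real.sqrt_pos.2 (by linarith)
  have hs1 : 1 / √s ≤ Real.pi := by
    have : 1 ≤ √s := Real.one_le_sqrt.2 hs
    rw [div_le_iff₀ hs0]
    nlinarith [Real.pi_gt_three]
  have hcont : Continuous fun θ : ℝ => Real.exp (-(s * (2 * (1 - Real.cos θ)))) := by fun_prop
  have hle : 1 / √s * Real.exp (-1)
      ≤ ∫ θ in Set.Icc (-Real.pi) Real.pi, Real.exp (-(s * (2 * (1 - Real.cos θ)))) := by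
    calc 1 / √s * Real.exp (-1) = ∫ _ in Set.Icc 0 (1 / √s), Real.exp (-1) := by
          simp [hs0.le]
      _ ≤ ∫ θ in Set.Icc 0 (1 / √s), Real.exp (-(s * (2 * (1 - Real.cos θ)))) := by
          refine setIntegral_mono_on (continuous_const.integrableOn_Icc) hcont.integrableOn_Icc
            measurableSet_Icc fun θ hθ => ?_
          rw [Real.exp_le_exp, neg_le_neg_iff]
          have h1 := @Real.one_sub_sq_div_two_le_cos θ
          have h2 : θ ^ 2 ≤ 1 / s := by
            calc θ ^ 2 ≤ (1 / √s) ^ 2 := pow_le_pow_left₀ hθ.1 hθ.2 2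
              _ = 1 / s := by rw [div_pow, Real.sq_sqrt (by linarith), one_pow]
          rw [le_div_iff₀ (by linarith)] at h2
          nlinarith
      _ ≤ _ := setIntegral_mono_set hcont.integrableOn_Icc
          (.of_forall fun _ => (Real.exp_pos _).le)
          (Set.Icc_subset_Icc (by linarith [Real.pi_pos]) hs1).eventuallyLE
  rw [returnProb, integral_circleMeasure, mul_left_comm]
  refine mul_le_mul_of_nonneg_left ?_ (by positivity)
  calc Real.exp (-1) = √s * (1 / √s * Real.exp (-1)) := by field_simp
    _ ≤ _ := mul_le_mul_of_nonneg_left hle hs0.le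

/-- The lattice Laplacian on functions `ℤ^d → ℝ`. -/
def latticeLaplacian (d : ℕ) : Module.End ℝ ((Fin d → ℤ) → ℝ) where
  toFun f z := ∑ i : Fin d, ((f (z + Pi.single i 1) - f z) + (f (z - Pi.single i 1) - f z))
  map_add' f g := by
    funext z
    simp only [Pi.add_apply, ← Finset.sum_add_distrib]
    exact Finset.sum_congr rfl fun i _ => by ring
  map_smul' c f := by
    funext z
    simp only [Pi.smul_apply, smul_eq_mul, RingHom.id_apply, Finset.mul_sum]
    exact Finset.sum_congr rfl fun i _ => by ring

/-- The transition operator `1 + aΔ` of a lazy simple random walk on `ℤ^d`. -/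
def lazyWalk (d : ℕ) (a : ℝ) : Module.End ℝ ((Fin d → ℤ) → ℝ) := 1 + a • latticeLaplacian d

section LatticeWalk

variable {d : ℕ}

lemma latticeLaplacian_apply (f : (Fin d → ℤ) → ℝ) (z : Fin d → ℤ) :
    latticeLaplacian d f z =
      ∑ i : Fin d, ((f (z + Pi.single i 1) - f z) + (f (z - Pi.single i 1) - f z)) := rfl

lemma lazyWalk_apply (a : ℝ) (f : (Fin d → ℤ) → ℝ) (z : Fin d → ℤ) :
    lazyWalk d a f z = f z + a * latticeLaplacian d f z := rfl

lemma neg_le_latticeLaplacian {f : (Fin d → ℤ) → ℝ} (hf : 0 ≤ f) (z : Fin d → ℤ) :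
    -(2 * d * f z) ≤ latticeLaplacian d f z := by
  calc -(2 * d * f z) = ∑ _ : Fin d, -(2 * f z) := by simp; ring
    _ ≤ _ := Finset.sum_le_sum fun i _ => by
      have h1 := hf (z + Pi.single i 1)
      have h2 := hf (z - Pi.single i 1)
      simp only [Pi.zero_apply] at h1 h2
      linarith

lemma lazyWalk_nonneg {a : ℝ} (ha : 0 ≤ a) (had : 2 * d * a ≤ 1) {f : (Fin d → ℤ) → ℝ}
    (hf : 0 ≤ f) : 0 ≤ lazyWalk d a f := by
  intro z
  rw [Pi.zero_apply, lazyWalk_apply]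
  have h1 := mul_le_mul_of_nonneg_left (neg_le_latticeLaplacian hf z) ha
  have h2 : 0 ≤ f z := hf z
  nlinarith [mul_le_mul_of_nonneg_right had h2]

lemma lazyWalk_mono {a : ℝ} (ha : 0 ≤ a) (had : 2 * d * a ≤ 1) {f g : (Fin d → ℤ) → ℝ}
    (hfg : f ≤ g) : lazyWalk d a f ≤ lazyWalk d a g := by
  rw [← sub_nonneg, ← map_sub]
  exact lazyWalk_nonneg ha had (sub_nonneg.2 hfg)

lemma lazyWalk_pow_mono {a : ℝ} (ha : 0 ≤ a) (had : 2 * d * a ≤ 1) {f g : (Fin d → ℤ) → ℝ}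
    (hfg : f ≤ g) (n : ℕ) : (lazyWalk d a ^ n) f ≤ (lazyWalk d a ^ n) g := by
  induction n with
  | zero => simpa
  | succ n ih =>
    simp only [pow_succ', Module.End.mul_apply]
    exact lazyWalk_mono ha had ih

lemma lazyWalk_pow_nonneg {a : ℝ} (ha : 0 ≤ a) (had : 2 * d * a ≤ 1) {f : (Fin d → ℤ) → ℝ}
    (hf : 0 ≤ f) (n : ℕ) : 0 ≤ (lazyWalk d a ^ n) f := by
  simpa using lazyWalk_pow_mono ha had hf n

lemma hasSum_latticeLaplacian {f : (Fin d → ℤ) → ℝ} {s : ℝ} (hf : HasSum f s) :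
    HasSum (latticeLaplacian d f) 0 := by
  have hshift : ∀ v : Fin d → ℤ, HasSum (fun z => f (z + v)) s := fun v =>
    (Equiv.addRight v).hasSum_iff.2 hf
  have h : ∀ i : Fin d, HasSum
      (fun z => (f (z + Pi.single i 1) - f z) + (f (z - Pi.single i 1) - f z)) 0 := fun i => by
    have h := ((hshift (Pi.single i 1)).sub hf).add ((hshift (-Pi.single i 1)).sub hf)
    simpa only [← sub_eq_add_neg, sub_self, add_zero] using h
  have := hasSum_sum (s := Finset.univ) fun i _ => h i
  rwa [Finset.sum_const_zero] at this

lemma linear_recursion_eq_sum {E : Type*} [AddCommGroup E] [Module ℝ E] (K : Module.End ℝ E)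
    {e h : ℕ → E} (h0 : e 0 = 0) (hs : ∀ n, e (n + 1) = K (e n) + h n) (n : ℕ) :
    e n = ∑ l ∈ Finset.range n, (K ^ (n - 1 - l)) (h l) := by
  induction n with
  | zero => simpa
  | succ n ih =>
    rw [hs, ih, map_sum, Finset.sum_range_succ]
    simp only [add_tsub_cancel_right, tsub_self, pow_zero, Module.End.one_apply]
    congr 1
    refine Finset.sum_congr rfl fun l hl => ?_
    rw [← Module.End.mul_apply, ← pow_succ']
    congr 2
    have := Finset.mem_range.1 hl
    omega

/-- The Fourier symbol of `-Δ` on `ℤ^d`. -/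
noncomputable def laplacianSymbol (θ : Fin d → ℝ) : ℝ := ∑ i, 2 * (1 - Real.cos (θ i))

/-- The even character of `ℤ^d` with frequency `θ`. -/
noncomputable def cosCharacter (z : Fin d → ℤ) (θ : Fin d → ℝ) : ℝ := ∏ i, Real.cos (z i * θ i)

lemma laplacianSymbol_nonneg (θ : Fin d → ℝ) : 0 ≤ laplacianSymbol θ :=
  Finset.sum_nonneg fun i _ => by linarith [Real.cos_le_one (θ i)]

lemma laplacianSymbol_le (θ : Fin d → ℝ) : laplacianSymbol θ ≤ 4 * d := by
  calc laplacianSymbol θ ≤ ∑ _ : Fin d, (4 : ℝ) :=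
        Finset.sum_le_sum fun i _ => by linarith [Real.neg_one_le_cos (θ i)]
    _ = 4 * d := by simp [mul_comm]

@[fun_prop]
lemma continuous_laplacianSymbol : Continuous (laplacianSymbol (d := d)) := by
  unfold laplacianSymbol; fun_prop

@[fun_prop]
lemma continuous_cosCharacter (z : Fin d → ℤ) : Continuous (cosCharacter z) := by
  unfold cosCharacter; fun_prop

lemma abs_cosCharacter_le_one (z : Fin d → ℤ) (θ : Fin d → ℝ) : |cosCharacter z θ| ≤ 1 := by
  rw [cosCharacter, Finset.abs_prod]
  exact Finset.prod_le_one (fun _ _ => abs_nonneg _) fun _ _ => Real.abs_cos_le_one _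

lemma cosCharacter_add_add_sub (z : Fin d → ℤ) (i : Fin d) (θ : Fin d → ℝ) :
    cosCharacter (z + Pi.single i 1) θ + cosCharacter (z - Pi.single i 1) θ =
      2 * Real.cos (θ i) * cosCharacter z θ := by
  simp only [cosCharacter]
  rw [← Finset.mul_prod_erase _ _ (Finset.mem_univ i),
    ← Finset.mul_prod_erase _ _ (Finset.mem_univ i),
    ← Finset.mul_prod_erase _ _ (Finset.mem_univ i)]
  have h1 : ∏ j ∈ Finset.univ.erase i, Real.cos (((z + Pi.single i 1 : Fin d → ℤ) j : ℤ) * θ j) =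
      ∏ j ∈ Finset.univ.erase i, Real.cos (z j * θ j) :=
    Finset.prod_congr rfl fun j hj => by simp [Finset.ne_of_mem_erase hj]
  have h2 : ∏ j ∈ Finset.univ.erase i, Real.cos (((z - Pi.single i 1 : Fin d → ℤ) j : ℤ) * θ j) =
      ∏ j ∈ Finset.univ.erase i, Real.cos (z j * θ j) :=
    Finset.prod_congr rfl fun j hj => by simp [Finset.ne_of_mem_erase hj]
  rw [h1, h2]
  simp only [Pi.add_apply, Pi.sub_apply, Pi.single_eq_same, Int.cast_add, Int.cast_sub,
    Int.cast_one, add_mul, sub_mul, one_mul, Real.cos_add, Real.cos_sub]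
  ring

lemma lazyWalk_cosCharacter (a : ℝ) (z : Fin d → ℤ) (θ : Fin d → ℝ) :
    lazyWalk d a (fun z => cosCharacter z θ) z =
      (1 - a * laplacianSymbol θ) * cosCharacter z θ := by
  have h : latticeLaplacian d (fun z => cosCharacter z θ) z =
      -(laplacianSymbol θ * cosCharacter z θ) := by
    rw [latticeLaplacian_apply, laplacianSymbol, Finset.sum_mul, ← Finset.sum_neg_distrib]
    exact Finset.sum_congr rfl fun i _ => by linarith [cosCharacter_add_add_sub z i θ]
  rw [lazyWalk_apply, h]
  ring

/-- The uniform probability measure on the torus `[-π, π]^d`. -/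
noncomputable def torusMeasure (d : ℕ) : Measure (Fin d → ℝ) :=
  Measure.pi fun _ => circleMeasure

instance : IsProbabilityMeasure (torusMeasure d) := by
  unfold torusMeasure; infer_instance

/-- The inverse Fourier transform of an even symbol. -/
noncomputable def cosTransform (φ : (Fin d → ℝ) → ℝ) (z : Fin d → ℤ) : ℝ :=
  ∫ θ, φ θ * cosCharacter z θ ∂torusMeasure d

lemma cosTransform_one : cosTransform (d := d) (fun _ => 1) = Pi.single 0 1 := by
  funext z
  simp only [cosTransform, one_mul, cosCharacter, torusMeasure]
  rw [integral_fintype_prod_eq_prod (fun i (x : ℝ) => Real.cos (z i * x))]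
  simp only [integral_cos_int_mul_circleMeasure, Pi.single_apply, funext_iff, Pi.zero_apply]
  simp [Fintype.prod_ite_zero]

lemma integrable_mul_cosCharacter {φ : (Fin d → ℝ) → ℝ} (hφ : Continuous φ)
    (hb : ∀ θ, |φ θ| ≤ 1) (z : Fin d → ℤ) :
    Integrable (fun θ => φ θ * cosCharacter z θ) (torusMeasure d) := by
  refine Integrable.of_bound (C := 1) (by fun_prop) (.of_forall fun θ => ?_)
  rw [Real.norm_eq_abs, abs_mul]
  exact mul_le_one₀ (hb θ) (abs_nonneg _) (abs_cosCharacter_le_one z θ)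

lemma lazyWalk_cosTransform (a : ℝ) {φ : (Fin d → ℝ) → ℝ} (hφ : Continuous φ)
    (hb : ∀ θ, |φ θ| ≤ 1) :
    lazyWalk d a (cosTransform φ) = cosTransform fun θ => (1 - a * laplacianSymbol θ) * φ θ := by
  funext z
  have hi := integrable_mul_cosCharacter hφ hb
  have h : ∀ θ, (1 - a * laplacianSymbol θ) * φ θ * cosCharacter z θ =
      φ θ * cosCharacter z θ + a * ∑ i : Fin d,
        ((φ θ * cosCharacter (z + Pi.single i 1) θ - φ θ * cosCharacter z θ) +
          (φ θ * cosCharacter (z - Pi.single i 1) θ - φ θ * cosCharacter z θ)) := fun θ => by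
    rw [mul_right_comm, ← lazyWalk_cosCharacter, lazyWalk_apply, latticeLaplacian_apply, add_mul,
      mul_assoc, Finset.sum_mul, mul_comm]
    congr 2
    exact Finset.sum_congr rfl fun i _ => by ring
  simp only [cosTransform, h]
  have hi' : ∀ i : Fin d, Integrable (fun θ =>
      ((φ θ * cosCharacter (z + Pi.single i 1) θ - φ θ * cosCharacter z θ) +
          (φ θ * cosCharacter (z - Pi.single i 1) θ - φ θ * cosCharacter z θ))) (torusMeasure d) :=
    fun i => ((hi _).sub (hi _)).add ((hi _).sub (hi _))
  rw [integral_add (hi z) ((integrable_finsetSum _ fun i _ => hi' i).const_mul a),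
    integral_const_mul, integral_finsetSum _ fun i _ => hi' i, lazyWalk_apply,
    latticeLaplacian_apply]
  congr 2
  refine Finset.sum_congr rfl fun i _ => ?_
  rw [integral_add (by exact (hi _).sub (hi _)) (by exact (hi _).sub (hi _)),
    integral_sub (hi _) (hi _),
    integral_sub (hi _) (hi _)]
  rfl

lemma one_sub_mul_laplacianSymbol_nonneg {a : ℝ} (ha : 0 ≤ a) (had : 4 * d * a ≤ 1)
    (θ : Fin d → ℝ) : 0 ≤ 1 - a * laplacianSymbol θ := by
  nlinarith [mul_le_mul_of_nonneg_left (laplacianSymbol_le θ) ha]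

lemma one_sub_mul_laplacianSymbol_le_one {a : ℝ} (ha : 0 ≤ a) (θ : Fin d → ℝ) :
    1 - a * laplacianSymbol θ ≤ 1 := by
  linarith [mul_nonneg ha (laplacianSymbol_nonneg θ)]

lemma lazyWalk_pow_cosTransform {a : ℝ} (ha : 0 ≤ a) (had : 4 * d * a ≤ 1)
    {φ : (Fin d → ℝ) → ℝ} (hφ : Continuous φ) (hb : ∀ θ, |φ θ| ≤ 1) (n : ℕ) :
    (lazyWalk d a ^ n) (cosTransform φ) =
      cosTransform fun θ => (1 - a * laplacianSymbol θ) ^ n * φ θ := by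
  induction n with
  | zero => simp
  | succ n ih =>
    rw [pow_succ', Module.End.mul_apply, ih, lazyWalk_cosTransform a (by fun_prop)]
    · simp only [pow_succ', mul_assoc]
    · intro θ
      rw [abs_mul, abs_pow, abs_of_nonneg (one_sub_mul_laplacianSymbol_nonneg ha had θ)]
      exact mul_le_one₀ (pow_le_one₀ (one_sub_mul_laplacianSymbol_nonneg ha had θ)
        (one_sub_mul_laplacianSymbol_le_one ha θ)) (abs_nonneg _) (hb θ)

lemma integral_exp_neg_mul_laplacianSymbol (s : ℝ) :
    ∫ θ, Real.exp (-(s * laplacianSymbol θ)) ∂torusMeasure d = returnProb s ^ d := by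
  have h : ∀ θ : Fin d → ℝ, Real.exp (-(s * laplacianSymbol θ)) =
      ∏ i, Real.exp (-(s * (2 * (1 - Real.cos (θ i))))) := fun θ => by
    rw [← Real.exp_sum, laplacianSymbol, Finset.mul_sum, Finset.sum_neg_distrib]
  simp only [h, torusMeasure]
  rw [integral_fintype_prod_eq_pow fun x => Real.exp (-(s * (2 * (1 - Real.cos x))))]
  simp [returnProb]

lemma integrable_exp_neg_mul_laplacianSymbol {s : ℝ} (hs : 0 ≤ s) :
    Integrable (fun θ => Real.exp (-(s * laplacianSymbol θ))) (torusMeasure d) := by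
  refine Integrable.of_bound (C := 1) (by fun_prop) (.of_forall fun θ => ?_)
  rw [Real.norm_eq_abs, abs_of_pos (Real.exp_pos _), Real.exp_le_one_iff, neg_nonpos]
  exact mul_nonneg hs (laplacianSymbol_nonneg θ)

lemma one_sub_mul_laplacianSymbol_pow_le {a μ : ℝ} (hμ : μ ≤ a) (ha : 0 ≤ a)
    (had : 4 * d * a ≤ 1) (n : ℕ) (θ : Fin d → ℝ) :
    (1 - a * laplacianSymbol θ) ^ n ≤ Real.exp (-(μ * n * laplacianSymbol θ)) := by
  calc (1 - a * laplacianSymbol θ) ^ n ≤ Real.exp (-(μ * laplacianSymbol θ)) ^ n := by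
        refine pow_le_pow_left₀ (one_sub_mul_laplacianSymbol_nonneg ha had θ) ?_ n
        have := Real.add_one_le_exp (-(μ * laplacianSymbol θ))
        linarith [mul_le_mul_of_nonneg_right hμ (laplacianSymbol_nonneg θ)]
    _ = _ := by rw [← Real.exp_nat_mul]; ring_nf

lemma lazyWalk_pow_pow_single_le {a b μ : ℝ} (hμ : 0 ≤ μ) (hμa : μ ≤ a) (hμb : μ ≤ b)
    (had : 4 * d * a ≤ 1) (hbd : 4 * d * b ≤ 1) (k l : ℕ) (z : Fin d → ℤ) :
    (lazyWalk d a ^ k) ((lazyWalk d b ^ l) (Pi.single 0 1)) z ≤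
      returnProb (μ * (k + l : ℕ)) ^ d := by
  have ha := hμ.trans hμa
  have hb := hμ.trans hμb
  have hpos := one_sub_mul_laplacianSymbol_nonneg (d := d) hb hbd
  have hpos' := one_sub_mul_laplacianSymbol_nonneg (d := d) ha had
  have hle : ∀ θ : Fin d → ℝ, (1 - b * laplacianSymbol θ) ^ l * 1 ≤ 1 := fun θ => by
    rw [mul_one]
    exact pow_le_one₀ (hpos θ) (one_sub_mul_laplacianSymbol_le_one hb θ)
  have hab : ∀ θ : Fin d → ℝ, |(1 - b * laplacianSymbol θ) ^ l * 1| ≤ 1 := fun θ => by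
    rw [abs_of_nonneg (by have := hpos θ; positivity)]
    exact hle θ
  rw [← cosTransform_one, lazyWalk_pow_cosTransform hb hbd (by fun_prop) (by simp),
    lazyWalk_pow_cosTransform ha had (by fun_prop) hab, cosTransform,
    ← integral_exp_neg_mul_laplacianSymbol]
  refine integral_mono (integrable_mul_cosCharacter (by fun_prop) (fun θ => ?_) z)
    (integrable_exp_neg_mul_laplacianSymbol (by positivity)) fun θ => ?_
  · rw [abs_mul, abs_pow, abs_of_nonneg (hpos' θ)]
    exact mul_le_one₀ (pow_le_one₀ (hpos' θ) (one_sub_mul_laplacianSymbol_le_one ha θ))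
      (abs_nonneg _) (hab θ)
  · have h1 := hpos θ
    have h2 := hpos' θ
    calc _ ≤ (1 - a * laplacianSymbol θ) ^ k * ((1 - b * laplacianSymbol θ) ^ l * 1) * 1 :=
          mul_le_mul_of_nonneg_left (le_of_abs_le (abs_cosCharacter_le_one z θ)) (by positivity)
      _ = (1 - a * laplacianSymbol θ) ^ k * (1 - b * laplacianSymbol θ) ^ l := by ring
      _ ≤ Real.exp (-(μ * k * laplacianSymbol θ)) * Real.exp (-(μ * l * laplacianSymbol θ)) := by
          gcongr
          · exact one_sub_mul_laplacianSymbol_pow_le hμa ha had k θ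
          · exact one_sub_mul_laplacianSymbol_pow_le hμb hb hbd l θ
      _ = _ := by rw [← Real.exp_add]; push_cast; ring_nf

lemma le_lazyWalk_pow_single_zero {a : ℝ} (ha : 0 ≤ a) (had : 8 * d * a ≤ 1) (k : ℕ) :
    returnProb (2 * a * k) ^ d ≤ (lazyWalk d a ^ k) (Pi.single 0 1) 0 := by
  have had' : 4 * d * a ≤ 1 := by
    have : 0 ≤ d * a := by positivity
    linarith
  rw [← cosTransform_one, lazyWalk_pow_cosTransform ha had' (by fun_prop) (by simp), cosTransform,
    ← integral_exp_neg_mul_laplacianSymbol]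
  have hpos := one_sub_mul_laplacianSymbol_nonneg (d := d) ha had'
  refine integral_mono (integrable_exp_neg_mul_laplacianSymbol (by positivity))
    (integrable_mul_cosCharacter (by fun_prop) (fun θ => ?_) 0) fun θ => ?_
  · rw [mul_one, abs_pow, abs_of_nonneg (hpos θ)]
    exact pow_le_one₀ (hpos θ) (one_sub_mul_laplacianSymbol_le_one ha θ)
  · have hc : cosCharacter 0 θ = 1 := by simp [cosCharacter]
    have hu0 : 0 ≤ a * laplacianSymbol θ := mul_nonneg ha (laplacianSymbol_nonneg θ)
    have hu1 : a * laplacianSymbol θ ≤ 1 / 2 := by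
      linarith [mul_le_mul_of_nonneg_left (laplacianSymbol_le θ) ha]
    have key : Real.exp (-(2 * (a * laplacianSymbol θ))) ≤ 1 - a * laplacianSymbol θ := by
      have h1 := Real.add_one_le_exp (2 * (a * laplacianSymbol θ))
      rw [Real.exp_neg, inv_le_iff_one_le_mul₀ (Real.exp_pos _)]
      nlinarith
    calc Real.exp (-(2 * a * k * laplacianSymbol θ))
        = Real.exp (-(2 * (a * laplacianSymbol θ))) ^ k := by rw [← Real.exp_nat_mul]; ring_nf
      _ ≤ (1 - a * laplacianSymbol θ) ^ k := pow_le_pow_left₀ (Real.exp_pos _).le key k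
      _ = _ := by rw [hc, mul_one, mul_one]

end LatticeWalk

/-- The transition operator of a pair of lazy walks on `ℤ^d × ℤ^d` with jump rates `a` and `b`,
killed with probability `δ` on the diagonal. -/
def trapWalk (d : ℕ) (a b δ : ℝ) : Module.End ℝ ((Fin d → ℤ) × (Fin d → ℤ) → ℝ) where
  toFun f q := f q + a * latticeLaplacian d (fun x => f (x, q.2)) q.1 +
    b * latticeLaplacian d (fun y => f (q.1, y)) q.2 - δ * if q.1 = q.2 then f q else 0
  map_add' f g := by
    funext q
    have h1 := congrFun (map_add (latticeLaplacian d) (fun x => f (x, q.2)) fun x => g (x, q.2)) q.1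
    have h2 := congrFun (map_add (latticeLaplacian d) (fun y => f (q.1, y)) fun y => g (q.1, y)) q.2
    simp only [Pi.add_def] at h1 h2 ⊢
    rw [h1, h2]
    split_ifs <;> ring
  map_smul' c f := by
    funext q
    have h1 := congrFun (map_smul (latticeLaplacian d) c (fun x => f (x, q.2))) q.1
    have h2 := congrFun (map_smul (latticeLaplacian d) c (fun y => f (q.1, y))) q.2
    simp only [Pi.smul_def, smul_eq_mul, RingHom.id_apply] at h1 h2 ⊢
    rw [h1, h2]
    split_ifs <;> ring

section TrapWalk

variable {d : ℕ} {a b δ : ℝ}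

lemma trapWalk_apply (f : (Fin d → ℤ) × (Fin d → ℤ) → ℝ) (q : (Fin d → ℤ) × (Fin d → ℤ)) :
    trapWalk d a b δ f q = f q + a * latticeLaplacian d (fun x => f (x, q.2)) q.1 +
      b * latticeLaplacian d (fun y => f (q.1, y)) q.2 - δ * if q.1 = q.2 then f q else 0 := rfl

lemma latticeLaplacian_const (c : ℝ) : latticeLaplacian d (fun _ => c) = 0 := by
  funext z
  simp [latticeLaplacian_apply]

lemma latticeLaplacian_comp_add_right (f : (Fin d → ℤ) → ℝ) (v z : Fin d → ℤ) :
    latticeLaplacian d (fun z => f (z + v)) z = latticeLaplacian d f (z + v) := by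
  simp only [latticeLaplacian_apply]
  refine Finset.sum_congr rfl fun i _ => ?_
  rw [add_right_comm, sub_add_eq_add_sub z]

lemma latticeLaplacian_comp_sub_left (f : (Fin d → ℤ) → ℝ) (v z : Fin d → ℤ) :
    latticeLaplacian d (fun z => f (v - z)) z = latticeLaplacian d f (v - z) := by
  simp only [latticeLaplacian_apply]
  refine Finset.sum_congr rfl fun i _ => ?_
  rw [add_comm, sub_add_eq_sub_sub, sub_sub_eq_add_sub, add_sub_right_comm]

lemma trapWalk_nonneg (ha : 0 ≤ a) (hb : 0 ≤ b) (hδ : 0 ≤ δ) (h : 2 * d * (a + b) + δ ≤ 1)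
    {f : (Fin d → ℤ) × (Fin d → ℤ) → ℝ} (hf : 0 ≤ f) : 0 ≤ trapWalk d a b δ f := by
  intro q
  rw [Pi.zero_apply, trapWalk_apply]
  have h1 := mul_le_mul_of_nonneg_left (neg_le_latticeLaplacian
    (f := fun x => f (x, q.2)) (fun x => hf (x, q.2)) q.1) ha
  have h2 := mul_le_mul_of_nonneg_left (neg_le_latticeLaplacian
    (f := fun y => f (q.1, y)) (fun y => hf (q.1, y)) q.2) hb
  have h3 : 0 ≤ f q := hf q
  have h4 : δ * (if q.1 = q.2 then f q else 0) ≤ δ * f q :=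
    mul_le_mul_of_nonneg_left (by split_ifs <;> simp [h3]) hδ
  nlinarith [mul_le_mul_of_nonneg_right h h3]

lemma trapWalk_pow_mono (ha : 0 ≤ a) (hb : 0 ≤ b) (hδ : 0 ≤ δ) (h : 2 * d * (a + b) + δ ≤ 1)
    {f g : (Fin d → ℤ) × (Fin d → ℤ) → ℝ} (hfg : f ≤ g) (n : ℕ) :
    (trapWalk d a b δ ^ n) f ≤ (trapWalk d a b δ ^ n) g := by
  induction n with
  | zero => simpa
  | succ n ih =>
    simp only [pow_succ', Module.End.mul_apply]
    rw [← sub_nonneg, ← map_sub]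
    exact trapWalk_nonneg ha hb hδ h (sub_nonneg.2 ih)

lemma trapWalk_pow_nonneg (ha : 0 ≤ a) (hb : 0 ≤ b) (hδ : 0 ≤ δ) (h : 2 * d * (a + b) + δ ≤ 1)
    {f : (Fin d → ℤ) × (Fin d → ℤ) → ℝ} (hf : 0 ≤ f) (n : ℕ) :
    0 ≤ (trapWalk d a b δ ^ n) f := by
  simpa using trapWalk_pow_mono ha hb hδ h hf n

lemma trapWalk_pow_snd_le (ha : 0 ≤ a) (hb : 0 ≤ b) (hδ : 0 ≤ δ)
    (h : 2 * d * (a + b) + δ ≤ 1) {u : (Fin d → ℤ) → ℝ} (hu : 0 ≤ u) (n : ℕ) :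
    (trapWalk d a b δ ^ n) (u ∘ Prod.snd) ≤ ((lazyWalk d b ^ n) u) ∘ Prod.snd := by
  have hbd : 2 * d * b ≤ 1 := by
    have : 0 ≤ 2 * d * a := by positivity
    linarith
  induction n with
  | zero => simp
  | succ n ih =>
    simp only [pow_succ', Module.End.mul_apply]
    have h1 := trapWalk_pow_mono ha hb hδ h ih 1
    rw [pow_one] at h1
    refine h1.trans fun q => ?_
    have h2 : 0 ≤ (lazyWalk d b ^ n) u q.2 := lazyWalk_pow_nonneg hb hbd hu n q.2
    have h3 : 0 ≤ δ * if q.1 = q.2 then (lazyWalk d b ^ n) u q.2 else 0 :=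
      mul_nonneg hδ (by split_ifs <;> simp [h2])
    simp only [trapWalk_apply, Function.comp_apply, latticeLaplacian_const, Pi.zero_apply,
      lazyWalk_apply]
    linarith

lemma hasSum_trapWalk {F : (Fin d → ℤ) × (Fin d → ℤ) → ℝ} {B : (Fin d → ℤ) → ℝ}
    (hF : ∀ x, HasSum (fun y => F (x, y)) (B x)) (x : Fin d → ℤ) :
    HasSum (fun y => trapWalk d a b δ F (x, y)) (lazyWalk d a B x - δ * F (x, x)) := by
  have h1 : HasSum (fun y => latticeLaplacian d (fun x' => F (x', y)) x)
      (latticeLaplacian d B x) := by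
    simp only [latticeLaplacian_apply]
    exact hasSum_sum fun i _ => ((hF _).sub (hF x)).add ((hF _).sub (hF x))
  have h2 := hasSum_latticeLaplacian (hF x)
  have h3 : HasSum (fun y => if x = y then F (x, y) else 0) (F (x, x)) := by
    convert hasSum_ite_eq x (F (x, x)) using 2 with y
    grind
  have := (((hF x).add (h1.mul_left a)).add (h2.mul_left b)).sub (h3.mul_left δ)
  rwa [mul_zero, add_zero] at this

lemma trapWalk_comp_shift (F : (Fin d → ℤ) × (Fin d → ℤ) → ℝ) (v : Fin d → ℤ) :
    trapWalk d a b δ (fun q => F (q.1 + v, q.2 + v)) =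
      fun q => trapWalk d a b δ F (q.1 + v, q.2 + v) := by
  funext q
  simp only [trapWalk_apply, add_left_inj]
  rw [latticeLaplacian_comp_add_right fun x => F (x, q.2 + v),
    latticeLaplacian_comp_add_right fun y => F (q.1 + v, y)]

lemma trapWalk_pow_comp_shift (F : (Fin d → ℤ) × (Fin d → ℤ) → ℝ) (v : Fin d → ℤ) (n : ℕ) :
    (trapWalk d a b δ ^ n) (fun q => F (q.1 + v, q.2 + v)) =
      fun q => (trapWalk d a b δ ^ n) F (q.1 + v, q.2 + v) := by
  induction n with
  | zero => simp
  | succ n ih =>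
    rw [pow_succ', Module.End.mul_apply, ih, trapWalk_comp_shift, Module.End.mul_apply]

lemma trapWalk_pow_one_eq (n : ℕ) (x y : Fin d → ℤ) :
    (trapWalk d a b δ ^ n) 1 (x, y) = (trapWalk d a b δ ^ n) 1 (x - y, 0) := by
  have h := congrFun (trapWalk_pow_comp_shift (a := a) (b := b) (δ := δ) 1 (-y) n) (x, y)
  simp only [← sub_eq_add_neg, sub_self] at h
  exact h

lemma lazyWalk_diag (k n : ℕ) (c : ℝ) (u : (Fin d → ℤ) → ℝ) :
    (lazyWalk d c ^ k) (fun z => (trapWalk d a b δ ^ n) (u ∘ Prod.snd) (z, z)) =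
      fun z => (trapWalk d a b δ ^ n) (((lazyWalk d c ^ k) u) ∘ Prod.snd) (z, z) := by
  induction k with
  | zero => simp
  | succ k ih =>
    rw [pow_succ', Module.End.mul_apply, ih, Module.End.mul_apply]
    generalize (lazyWalk d c ^ k) u = u
    funext z
    let ev : ((Fin d → ℤ) → ℝ) →ₗ[ℝ] ℝ := LinearMap.proj (z, z) ∘ₗ (trapWalk d a b δ ^ n) ∘ₗ
      LinearMap.funLeft ℝ ℝ Prod.snd
    have hev : ∀ u, (trapWalk d a b δ ^ n) (u ∘ Prod.snd) (z, z) = ev u := fun _ => rfl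
    have hshift : ∀ v, (trapWalk d a b δ ^ n) (u ∘ Prod.snd) (z + v, z + v) =
        ev fun y => u (y + v) := fun v =>
      (congrFun (trapWalk_pow_comp_shift (u ∘ Prod.snd) v n) (z, z)).symm
    have hlap : latticeLaplacian d u = ∑ i : Fin d, (((fun y => u (y + Pi.single i 1)) - u) +
        ((fun y => u (y + -Pi.single i 1)) - u)) := by
      funext y
      simp [latticeLaplacian_apply, Finset.sum_apply, sub_eq_add_neg]
    have hl : lazyWalk d c u = u + c • latticeLaplacian d u := rfl
    rw [lazyWalk_apply, latticeLaplacian_apply, hev (lazyWalk d c u), hl, map_add, map_smul, hlap,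
      map_sum]
    simp only [sub_eq_add_neg (a := z), hshift, hev, map_add, map_sub, smul_eq_mul]

lemma trapWalk_comp_sub (ψ : (Fin d → ℤ) → ℝ) (x : Fin d → ℤ) :
    trapWalk d a b δ (fun q => ψ (q.1 - q.2)) (x, 0) =
      lazyWalk d (a + b) ψ x - δ * ψ 0 * (Pi.single 0 1 : (Fin d → ℤ) → ℝ) x := by
  have h1 : latticeLaplacian d (fun x => ψ (x - 0)) x = latticeLaplacian d ψ x := by simp
  simp only [trapWalk_apply]
  rw [latticeLaplacian_comp_sub_left, h1, sub_zero, lazyWalk_apply, Pi.single_apply]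
  split_ifs with h
  · subst h; ring
  · ring

end TrapWalk

lemma tendsto_returnProb : Tendsto returnProb atTop (𝓝 0) := by
  obtain ⟨C, hC, h⟩ := exists_sqrt_mul_returnProb_le
  refine squeeze_zero' (.of_forall returnProb_nonneg) ?_
    (tendsto_const_nhds (x := C).div_atTop Real.tendsto_sqrt_atTop)
  filter_upwards [eventually_gt_atTop 0] with s hs
  rw [le_div_iff₀ (Real.sqrt_pos.2 hs), mul_comm]
  exact h s hs

lemma exists_mul_returnProb_pow_le {d : ℕ} (hd : 2 ≤ d) :
    ∃ C : ℝ, 0 < C ∧ ∀ s : ℝ, 0 ≤ s → s * returnProb s ^ d ≤ C * returnProb s ^ (d - 2) := by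
  obtain ⟨C, hC, h⟩ := exists_sqrt_mul_returnProb_le
  refine ⟨C ^ 2, by positivity, fun s hs => ?_⟩
  have hr := returnProb_nonneg s
  obtain rfl | hs' := hs.eq_or_lt
  · rw [zero_mul]; positivity
  calc s * returnProb s ^ d = (√s * returnProb s) ^ 2 * returnProb s ^ (d - 2) := by
        rw [mul_pow, Real.sq_sqrt hs, mul_assoc, ← pow_add, Nat.add_sub_cancel' hd]
    _ ≤ _ := by
        gcongr
        exact h s hs'

lemma exists_nat_mul_returnProb_pow_le {d : ℕ} (hd : 2 ≤ d) {μ : ℝ} (hμ : 0 < μ) :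
    ∃ M : ℝ, 0 < M ∧ ∀ m : ℕ, m * returnProb (μ * (m - 1 : ℕ)) ^ d ≤ M := by
  obtain ⟨C, hC, h⟩ := exists_mul_returnProb_pow_le hd
  refine ⟨1 + C / μ, by positivity, fun m => ?_⟩
  cases m with
  | zero => simp; positivity
  | succ m =>
    rw [Nat.add_sub_cancel]
    have hs : 0 ≤ μ * m := by positivity
    have h0 := returnProb_nonneg (μ * m)
    have h1 := returnProb_le_one hs
    have h2 : m * returnProb (μ * m) ^ d ≤ C / μ := by
      rw [le_div_iff₀ hμ]
      calc m * returnProb (μ * m) ^ d * μ = μ * m * returnProb (μ * m) ^ d := by ring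
        _ ≤ C * returnProb (μ * m) ^ (d - 2) := h _ hs
        _ ≤ C := mul_le_of_le_one_right hC.le (pow_le_one₀ h0 h1)
    have h3 := pow_le_one₀ (n := d) h0 h1
    push_cast
    linarith

lemma tendsto_returnProb_pow_nat {d : ℕ} (hd : d ≠ 0) {μ : ℝ} (hμ : 0 < μ) :
    Tendsto (fun m : ℕ => returnProb (μ * (m - 1 : ℕ)) ^ d) atTop (𝓝 0) := by
  have h : Tendsto (fun m : ℕ => μ * (m - 1 : ℕ)) atTop atTop :=
    (tendsto_natCast_atTop_atTop.comp (tendsto_sub_atTop_nat 1)).const_mul_atTop hμ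
  simpa [hd] using (tendsto_returnProb.comp h).pow d

lemma tendsto_nat_mul_returnProb_pow {d : ℕ} (hd : 3 ≤ d) {μ : ℝ} (hμ : 0 < μ) :
    Tendsto (fun m : ℕ => m * returnProb (μ * (m - 1 : ℕ)) ^ d) atTop (𝓝 0) := by
  obtain ⟨C, hC, h⟩ := exists_mul_returnProb_pow_le (d := d) (by omega)
  have h1 := tendsto_returnProb_pow_nat (d := d) (by omega) hμ
  have h2 := (tendsto_returnProb_pow_nat (d := d - 2) (by omega) hμ).const_mul (C / μ)
  have h3 := h1.add h2
  rw [mul_zero, add_zero] at h3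
  refine squeeze_zero' (.of_forall fun m => ?_) ?_ h3
  · have := returnProb_nonneg (μ * (m - 1 : ℕ))
    positivity
  · filter_upwards [eventually_ge_atTop 1] with m hm
    obtain ⟨m, rfl⟩ := Nat.exists_eq_add_of_le' hm
    rw [Nat.add_sub_cancel]
    have := h (μ * m) (by positivity)
    rw [Nat.cast_add_one, add_mul, one_mul, add_comm, div_mul_eq_mul_div]
    gcongr
    rw [le_div_iff₀ hμ]
    linarith

section Survival

variable {d : ℕ} {a b δ : ℝ}

lemma trapWalk_pow_one_antitone (ha : 0 ≤ a) (hb : 0 ≤ b) (hδ : 0 ≤ δ)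
    (h : 2 * d * (a + b) + δ ≤ 1) (q : (Fin d → ℤ) × (Fin d → ℤ)) :
    Antitone fun n => (trapWalk d a b δ ^ n) 1 q := by
  refine antitone_nat_of_succ_le fun n => ?_
  rw [pow_succ, Module.End.mul_apply]
  refine trapWalk_pow_mono ha hb hδ h (fun q => ?_) n q
  have : 0 ≤ δ * if q.1 = q.2 then (1 : ℝ) else 0 := mul_nonneg hδ (by split_ifs <;> simp)
  simp only [trapWalk_apply, Pi.one_apply, latticeLaplacian_const, Pi.zero_apply]
  linarith

lemma survival_mul_green_le_one (ha : 0 ≤ a) (hb : 0 ≤ b) (hδ : 0 ≤ δ)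
    (h : 2 * d * (a + b) + δ ≤ 1) (n : ℕ) :
    (trapWalk d a b δ ^ n) 1 0 *
      (δ * ∑ k ∈ Finset.range n, (lazyWalk d (a + b) ^ k) (Pi.single 0 1) 0) ≤ 1 := by
  set ψ : ℕ → (Fin d → ℤ) → ℝ := fun n x => (trapWalk d a b δ ^ n) 1 (x, 0) with hψ
  have hψ0 : ∀ n, (trapWalk d a b δ ^ n) 1 0 = ψ n 0 := fun n => rfl
  have hab : 0 ≤ a + b := add_nonneg ha hb
  have hg : ∀ k, 0 ≤ (lazyWalk d (a + b) ^ k) (Pi.single 0 1) (0 : Fin d → ℤ) := fun k =>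
    lazyWalk_pow_nonneg hab (by linarith) (Pi.single_nonneg.2 zero_le_one) k 0
  have hrec : ∀ n, 1 - ψ (n + 1) =
      lazyWalk d (a + b) (1 - ψ n) + (δ * ψ n 0) • (Pi.single 0 1 : (Fin d → ℤ) → ℝ) := fun n => by
    have h1 : lazyWalk d (a + b) (1 : (Fin d → ℤ) → ℝ) = 1 := by
      funext z
      rw [lazyWalk_apply, show (1 : (Fin d → ℤ) → ℝ) = fun _ => 1 from rfl, latticeLaplacian_const]
      simp
    have h2 : (trapWalk d a b δ ^ n) 1 = fun q => ψ n (q.1 - q.2) :=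
      funext fun q => trapWalk_pow_one_eq n q.1 q.2
    funext x
    have h3 : ψ (n + 1) x = trapWalk d a b δ ((trapWalk d a b δ ^ n) 1) (x, 0) := by
      rw [← Module.End.mul_apply, ← pow_succ']
    rw [map_sub, h1, Pi.sub_apply, h3, h2, trapWalk_comp_sub]
    simp only [Pi.add_apply, Pi.sub_apply, Pi.smul_apply, smul_eq_mul]
    ring
  have hsum := congrFun (linear_recursion_eq_sum (lazyWalk d (a + b)) (e := fun n => 1 - ψ n)
    (by funext x; simp [hψ]) hrec n) 0
  simp only [map_smul, Finset.sum_apply, Pi.smul_apply, Pi.sub_apply, Pi.one_apply,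
    smul_eq_mul] at hsum
  have hpos : 0 ≤ ψ n 0 := trapWalk_pow_nonneg ha hb hδ h (f := 1) (fun _ => zero_le_one) n (0, 0)
  rw [hψ0, ← Finset.sum_range_reflect]
  calc ψ n 0 * (δ * ∑ j ∈ Finset.range n, (lazyWalk d (a + b) ^ (n - 1 - j)) (Pi.single 0 1) 0)
      = ∑ j ∈ Finset.range n,
          δ * ψ n 0 * (lazyWalk d (a + b) ^ (n - 1 - j)) (Pi.single 0 1) 0 := by
        rw [← mul_assoc, Finset.mul_sum, mul_comm δ]
    _ ≤ ∑ j ∈ Finset.range n,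
          δ * ψ j 0 * (lazyWalk d (a + b) ^ (n - 1 - j)) (Pi.single 0 1) 0 := by
        refine Finset.sum_le_sum fun j hj => mul_le_mul_of_nonneg_right
          (mul_le_mul_of_nonneg_left ?_ hδ) (hg _)
        exact trapWalk_pow_one_antitone ha hb hδ h (0, 0) (Finset.mem_range.1 hj).le
    _ = 1 - ψ n 0 := hsum.symm
    _ ≤ 1 := by linarith

lemma tendsto_survival_dim_two (ha : 0 < a) (hb : 0 < b) (hδ : 0 < δ)
    (h : 8 * (2 : ℕ) * (a + b) + δ ≤ 1) :
    Tendsto (fun n => (trapWalk 2 a b δ ^ n) 1 0) atTop (𝓝 0) := by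
  have hab : 0 < a + b := add_pos ha hb
  have h' : 2 * (2 : ℕ) * (a + b) + δ ≤ 1 := by push_cast at h ⊢; linarith
  set G : ℕ → ℝ := fun k => (lazyWalk 2 (a + b) ^ k) (Pi.single 0 1) 0
  have hG : ∀ k : ℕ, returnProb (2 * (a + b) * k) ^ 2 ≤ G k := fun k =>
    le_lazyWalk_pow_single_zero hab.le (by linarith) k
  have hG0 : ∀ k, 0 ≤ G k := fun k => (sq_nonneg _).trans (hG k)
  have hns : ¬ Summable G := fun hs => by
    obtain ⟨c, hc, hle⟩ := exists_le_sqrt_mul_returnProb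
    refine Real.not_summable_one_div_natCast ?_
    refine Summable.of_norm_bounded_eventually_nat
      (g := fun k => (2 * (a + b) / c ^ 2) * G k) (hs.mul_left _) ?_
    have hlim : Tendsto (fun k : ℕ => 2 * (a + b) * k) atTop atTop :=
      tendsto_natCast_atTop_atTop.const_mul_atTop (by positivity)
    filter_upwards [hlim.eventually_ge_atTop 1, eventually_gt_atTop 0] with k hk hk0
    have hk0' : (0 : ℝ) < k := by exact_mod_cast hk0
    have h1 : c ^ 2 ≤ 2 * (a + b) * k * returnProb (2 * (a + b) * k) ^ 2 := by
      calc c ^ 2 ≤ (√(2 * (a + b) * k) * returnProb (2 * (a + b) * k)) ^ 2 :=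
            pow_le_pow_left₀ hc.le (hle _ hk) 2
        _ = _ := by rw [mul_pow, Real.sq_sqrt (by positivity)]
    have h2 := h1.trans (mul_le_mul_of_nonneg_left (hG k) (by positivity))
    rw [Real.norm_of_nonneg (by positivity), div_mul_eq_mul_div,
      div_le_div_iff₀ hk0' (by positivity)]
    linarith
  rw [not_summable_iff_tendsto_nat_atTop_of_nonneg hG0] at hns
  have hlim := hns.const_mul_atTop hδ
  refine squeeze_zero' (.of_forall fun n => ?_) ?_ (tendsto_inv_atTop_zero.comp hlim)
  · exact trapWalk_pow_nonneg ha.le hb.le hδ.le h' (f := 1) (fun _ => zero_le_one) n 0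
  · filter_upwards [hlim.eventually_gt_atTop 0] with n hn
    rw [Function.comp_apply, ← one_div, le_div_iff₀ hn]
    exact survival_mul_green_le_one ha.le hb.le hδ.le h' n

lemma lazyWalk_pow_diag_le {μ : ℝ} (hμ : 0 ≤ μ) (hμa : μ ≤ a) (hμb : μ ≤ b) (hδ : 0 ≤ δ)
    (h : 4 * d * (a + b) + δ ≤ 1) (k l R : ℕ) (x : Fin d → ℤ) :
    (lazyWalk d a ^ k)
      (fun z => (trapWalk d a b δ ^ (R + l)) (Pi.single 0 1 ∘ Prod.snd) (z, z)) x ≤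
      returnProb (μ * (k + l : ℕ)) ^ d * (trapWalk d a b δ ^ R) 1 0 := by
  have ha := hμ.trans hμa
  have hb := hμ.trans hμb
  have hda : 0 ≤ d * a := by positivity
  have hdb : 0 ≤ d * b := by positivity
  have h' : 2 * d * (a + b) + δ ≤ 1 := by linarith
  set u := (lazyWalk d b ^ l) (Pi.single 0 1)
  set D := returnProb (μ * (k + l : ℕ)) ^ d
  have h1 : (trapWalk d a b δ ^ (R + l)) (Pi.single 0 1 ∘ Prod.snd) ≤
      (trapWalk d a b δ ^ R) (u ∘ Prod.snd) := by
    rw [pow_add, Module.End.mul_apply]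
    exact trapWalk_pow_mono ha hb hδ h'
      (trapWalk_pow_snd_le ha hb hδ h' (Pi.single_nonneg.2 zero_le_one) l) R
  have h2 : ((lazyWalk d a ^ k) u) ∘ Prod.snd ≤
      (D • 1 : (Fin d → ℤ) × (Fin d → ℤ) → ℝ) := fun q => by
    have := lazyWalk_pow_pow_single_le hμ hμa hμb (by linarith) (by linarith) k l q.2
    rwa [Pi.smul_apply, Pi.one_apply, smul_eq_mul, mul_one]
  calc _ ≤ (lazyWalk d a ^ k) (fun z => (trapWalk d a b δ ^ R) (u ∘ Prod.snd) (z, z)) x :=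
        lazyWalk_pow_mono ha (by linarith) (fun z => h1 (z, z)) k x
    _ = (trapWalk d a b δ ^ R) (((lazyWalk d a ^ k) u) ∘ Prod.snd) (x, x) := by
        rw [lazyWalk_diag]
    _ ≤ (trapWalk d a b δ ^ R) (D • 1) (x, x) := trapWalk_pow_mono ha hb hδ h' h2 R (x, x)
    _ = D * (trapWalk d a b δ ^ R) 1 0 := by
        rw [map_smul, Pi.smul_apply, smul_eq_mul, trapWalk_pow_one_eq, sub_self]
        rfl

/-- The expected surviving mass at `x` after `n` steps of the discrete-time trapping walk. -/
noncomputable def trapMass (d : ℕ) (a b δ : ℝ) (n : ℕ) (x : Fin d → ℤ) : ℝ :=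
  ∑' y, (trapWalk d a b δ ^ n) (Pi.single 0 1 ∘ Prod.snd) (x, y)

lemma exists_hasSum_trapWalk_pow (n : ℕ) : ∃ B : (Fin d → ℤ) → ℝ, ∀ x,
    HasSum (fun y => (trapWalk d a b δ ^ n) (Pi.single 0 1 ∘ Prod.snd) (x, y)) (B x) := by
  induction n with
  | zero => exact ⟨fun _ => 1, fun x => hasSum_pi_single 0 1⟩
  | succ n ih =>
    obtain ⟨B, hB⟩ := ih
    simp only [pow_succ', Module.End.mul_apply]
    exact ⟨_, fun x => hasSum_trapWalk hB x⟩

lemma hasSum_trapMass (n : ℕ) (x : Fin d → ℤ) :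
    HasSum (fun y => (trapWalk d a b δ ^ n) (Pi.single 0 1 ∘ Prod.snd) (x, y))
      (trapMass d a b δ n x) := by
  obtain ⟨B, hB⟩ := exists_hasSum_trapWalk_pow (d := d) (a := a) (b := b) (δ := δ) n
  exact (hB x).summable.hasSum

lemma one_sub_trapMass_eq_sum (n : ℕ) :
    1 - trapMass d a b δ n = ∑ l ∈ Finset.range n, (lazyWalk d a ^ (n - 1 - l))
      (δ • fun z => (trapWalk d a b δ ^ l) (Pi.single 0 1 ∘ Prod.snd) (z, z)) := by
  refine linear_recursion_eq_sum (lazyWalk d a) (e := fun n => 1 - trapMass d a b δ n) ?_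
    (fun n => ?_) n
  · funext x
    have h : trapMass d a b δ 0 x = 1 :=
      (hasSum_trapMass 0 x).unique (hasSum_pi_single (0 : Fin d → ℤ) (1 : ℝ))
    simp [h]
  · have h1 : lazyWalk d a (1 : (Fin d → ℤ) → ℝ) = 1 := by
      funext z
      rw [lazyWalk_apply, show (1 : (Fin d → ℤ) → ℝ) = fun _ => 1 from rfl, latticeLaplacian_const]
      simp
    funext x
    have h2 := hasSum_trapWalk (a := a) (b := b) (δ := δ)
      (hasSum_trapMass (a := a) (b := b) (δ := δ) n) x
    rw [← Module.End.mul_apply, ← pow_succ'] at h2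
    have h3 := (hasSum_trapMass (n + 1) x).unique h2
    rw [Pi.sub_apply, h3, map_sub, h1]
    simp only [Pi.add_apply, Pi.sub_apply, Pi.smul_apply, smul_eq_mul]
    ring

lemma single_comp_snd_nonneg :
    0 ≤ ((Pi.single 0 1 : (Fin d → ℤ) → ℝ) ∘ Prod.snd : (Fin d → ℤ) × (Fin d → ℤ) → ℝ) :=
  fun q => (Pi.single_nonneg.2 zero_le_one : (0 : (Fin d → ℤ) → ℝ) ≤ Pi.single 0 1) q.2

lemma trapMass_nonneg (ha : 0 ≤ a) (hb : 0 ≤ b) (hδ : 0 ≤ δ) (h : 2 * d * (a + b) + δ ≤ 1)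
    (n : ℕ) (x : Fin d → ℤ) : 0 ≤ trapMass d a b δ n x :=
  tsum_nonneg fun y => trapWalk_pow_nonneg ha hb hδ h
    single_comp_snd_nonneg n (x, y)

lemma trapMass_le_one (ha : 0 ≤ a) (hb : 0 ≤ b) (hδ : 0 ≤ δ) (h : 2 * d * (a + b) + δ ≤ 1)
    (n : ℕ) (x : Fin d → ℤ) : trapMass d a b δ n x ≤ 1 := by
  have hdb : 0 ≤ d * b := by positivity
  have key := congrFun (one_sub_trapMass_eq_sum (d := d) (a := a) (b := b) (δ := δ) n) x
  rw [Pi.sub_apply, Pi.one_apply, Finset.sum_apply] at key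
  rw [← sub_nonneg, key]
  refine Finset.sum_nonneg fun l _ => lazyWalk_pow_nonneg ha (by linarith) (fun z => ?_) _ x
  exact mul_nonneg hδ (trapWalk_pow_nonneg ha hb hδ h
    single_comp_snd_nonneg l (z, z))

lemma one_sub_trapMass_le {μ : ℝ} (hμ : 0 ≤ μ) (hμa : μ ≤ a) (hμb : μ ≤ b) (hδ : 0 ≤ δ)
    (h : 4 * d * (a + b) + δ ≤ 1) (R m : ℕ) (x : Fin d → ℤ) :
    1 - trapMass d a b δ (R + m) x ≤ δ * (R * returnProb (μ * (R + m - 1 : ℕ)) ^ d +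
      (trapWalk d a b δ ^ R) 1 0 * (m * returnProb (μ * (m - 1 : ℕ)) ^ d)) := by
  have key := congrFun (one_sub_trapMass_eq_sum (d := d) (a := a) (b := b) (δ := δ) (R + m)) x
  rw [Pi.sub_apply, Pi.one_apply, Finset.sum_apply] at key
  simp only [map_smul, Pi.smul_apply, smul_eq_mul] at key
  rw [key, ← Finset.mul_sum, Finset.sum_range_add]
  refine mul_le_mul_of_nonneg_left (add_le_add ?_ ?_) hδ
  · refine (Finset.sum_le_card_nsmul _ _ (returnProb (μ * (R + m - 1 : ℕ)) ^ d)
      fun l hl => ?_).trans_eq (by simp)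
    have hl' := Finset.mem_range.1 hl
    have := lazyWalk_pow_diag_le hμ hμa hμb hδ h (R + m - 1 - l) l 0 x
    rwa [zero_add, pow_zero, Module.End.one_apply, Pi.one_apply, mul_one,
      Nat.sub_add_cancel (by omega)] at this
  · refine (Finset.sum_le_card_nsmul _ _
      (returnProb (μ * (m - 1 : ℕ)) ^ d * (trapWalk d a b δ ^ R) 1 0)
      fun j hj => ?_).trans_eq (by simp; ring)
    have hj' := Finset.mem_range.1 hj
    have := lazyWalk_pow_diag_le hμ hμa hμb hδ h (R + m - 1 - (R + j)) j R x
    rwa [show R + m - 1 - (R + j) + j = m - 1 by omega] at this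

lemma tendsto_trapMass (hd : 2 ≤ d) (ha : 0 < a) (hb : 0 < b) (hδ : 0 < δ)
    (h : 8 * d * (a + b) + δ ≤ 1) (x : Fin d → ℤ) :
    Tendsto (fun n => trapMass d a b δ n x) atTop (𝓝 1) := by
  have hdab : 0 ≤ d * (a + b) := by positivity
  have h4 : 4 * d * (a + b) + δ ≤ 1 := by linarith
  have h2 : 2 * d * (a + b) + δ ≤ 1 := by linarith
  have hμ : 0 < min a b := lt_min ha hb
  have hle := one_sub_trapMass_le hμ.le (min_le_left a b) (min_le_right a b) hδ.le h4
  have hnn : ∀ n, 0 ≤ 1 - trapMass d a b δ n x := fun n =>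
    sub_nonneg.2 (trapMass_le_one ha.le hb.le hδ.le h2 n x)
  suffices hlim : Tendsto (fun n => 1 - trapMass d a b δ n x) atTop (𝓝 0) by
    simpa using (tendsto_const_nhds (x := (1 : ℝ))).sub hlim
  obtain rfl | hd3 := hd.eq_or_lt
  · obtain ⟨M, hM, hMle⟩ := exists_nat_mul_returnProb_pow_le le_rfl hμ
    rw [Metric.tendsto_atTop]
    intro ε hε
    obtain ⟨R, hR⟩ := ((tendsto_survival_dim_two ha hb hδ h).eventually_lt_const
      (show 0 < ε / 2 / (δ * M) by positivity)).exists
    rw [lt_div_iff₀ (by positivity)] at hR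
    have hS := trapWalk_pow_nonneg ha.le hb.le hδ.le h2 (f := 1) (fun _ => zero_le_one) R 0
    rw [Pi.zero_apply] at hS
    have hD := (tendsto_returnProb_pow_nat two_ne_zero hμ).const_mul (δ * R)
    rw [mul_zero] at hD
    obtain ⟨N, hN⟩ := eventually_atTop.1 (hD.eventually_lt_const (half_pos hε))
    refine ⟨R + N, fun n hn => ?_⟩
    obtain ⟨m, rfl⟩ := Nat.exists_eq_add_of_le (show R ≤ n by omega)
    rw [Real.dist_0_eq_abs, abs_of_nonneg (hnn _)]
    have h1 := hle R m x
    have h3 := hN (R + m) (by omega)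
    have h5 := mul_le_mul_of_nonneg_left (mul_le_mul_of_nonneg_left (hMle m) hS) hδ.le
    linarith
  · have hlim := (tendsto_nat_mul_returnProb_pow hd3 hμ).const_mul δ
    rw [mul_zero] at hlim
    refine squeeze_zero hnn (fun n => ?_) hlim
    simpa using hle 0 n x

end Survival

lemma hasSum_poisson (s : ℝ) : HasSum (fun n : ℕ => Real.exp (-s) * (s ^ n / n.factorial)) 1 := by
  have h := (NormedSpace.expSeries_div_hasSum_exp s).mul_left (Real.exp (-s))
  rwa [← Real.exp_eq_exp_ℝ, ← Real.exp_add, neg_add_cancel, Real.exp_zero] at h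

lemma tendsto_poisson_average {β : ℕ → ℝ} (hβ0 : ∀ n, 0 ≤ β n) (hβ1 : ∀ n, β n ≤ 1)
    (hβ : Tendsto β atTop (𝓝 1)) {F : ℝ → ℝ}
    (hF : ∀ s, 0 ≤ s →
      HasSum (fun n : ℕ => Real.exp (-s) * (s ^ n / n.factorial) * β n) (F s)) :
    Tendsto F atTop (𝓝 1) := by
  have hdiff : ∀ s, 0 ≤ s →
      HasSum (fun n : ℕ => Real.exp (-s) * (s ^ n / n.factorial) * (1 - β n)) (1 - F s) :=
    fun s hs => by simpa only [mul_sub, mul_one] using (hasSum_poisson s).sub (hF s hs)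
  rw [Metric.tendsto_atTop']
  intro ε hε
  obtain ⟨N, hN⟩ := eventually_atTop.1
    (hβ.eventually_const_lt (show 1 - ε / 2 < 1 by linarith))
  have hhead : Tendsto (fun s : ℝ => ∑ n ∈ Finset.range N,
      Real.exp (-s) * (s ^ n / n.factorial)) atTop (𝓝 0) := by
    have : ∀ n ∈ Finset.range N, Tendsto (fun s : ℝ => Real.exp (-s) * (s ^ n / n.factorial))
        atTop (𝓝 0) := fun n _ => by
      have h := (Real.tendsto_pow_mul_exp_neg_atTop_nhds_zero n).div_const (n.factorial : ℝ)
      rw [zero_div] at h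
      exact h.congr fun s => by ring
    simpa using tendsto_finsetSum _ this
  obtain ⟨S, hS⟩ := eventually_atTop.1 (hhead.eventually_lt_const (half_pos hε))
  refine ⟨max S 0, fun s hs => ?_⟩
  have hs0 : 0 ≤ s := (le_max_right S 0).trans hs.le
  have hp : ∀ n : ℕ, 0 ≤ Real.exp (-s) * (s ^ n / n.factorial) := fun n => by positivity
  have hlo : 0 ≤ 1 - F s :=
    (hdiff s hs0).nonneg fun n => mul_nonneg (hp n) (sub_nonneg.2 (hβ1 n))
  have hup : 1 - F s ≤
      1 * (ε / 2) + ∑ n ∈ Finset.range N, Real.exp (-s) * (s ^ n / n.factorial) := by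
    have hfin : HasSum
        (fun n => if n ∈ Finset.range N then Real.exp (-s) * (s ^ n / n.factorial) else 0)
        (∑ n ∈ Finset.range N, Real.exp (-s) * (s ^ n / n.factorial)) := by
      rw [← Finset.sum_congr rfl fun n hn => if_pos hn]
      exact hasSum_sum_of_ne_finset_zero fun n hn => if_neg hn
    refine hasSum_le (fun n => ?_) (hdiff s hs0) (((hasSum_poisson s).mul_right (ε / 2)).add hfin)
    split_ifs with hn
    · have h1 : 0 ≤ Real.exp (-s) * (s ^ n / n.factorial) * (ε / 2) :=
        mul_nonneg (hp n) (half_pos hε).le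
      have h2 := mul_le_mul_of_nonneg_left (sub_le_self 1 (hβ0 n)) (hp n)
      linarith
    · rw [add_zero]
      have h1 := hN n (by simpa using hn)
      exact mul_le_mul_of_nonneg_left (by linarith) (hp n)
  have h3 := hS s ((le_max_left S 0).trans hs.le)
  rw [Real.dist_eq, abs_lt]
  constructor <;> linarith

lemma hasSum_comm_of_nonneg {α β : Type*} {f : α → β → ℝ} (hf : ∀ i j, 0 ≤ f i j)
    {u : α → ℝ} {v : β → ℝ} {c : ℝ} (hu : ∀ i, HasSum (f i) (u i))
    (hv : ∀ j, HasSum (fun i => f i j) (v j)) (hc : HasSum u c) : HasSum v c := by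
  have hs : Summable fun p : α × β => f p.1 p.2 := by
    refine (summable_prod_of_nonneg fun p => hf p.1 p.2).2 ⟨fun i => (hu i).summable, ?_⟩
    simpa only [(hu _).tsum_eq] using hc.summable
  have h1 := hs.hasSum
  have h2 := (h1.prod_fiberwise hu).unique hc
  rw [h2] at h1
  exact HasSum.prod_fiberwise ((Equiv.prodComm β α).hasSum_iff.2 h1) hv

section Semigroup

variable {E : Type*} [NormedAddCommGroup E] [NormedSpace ℝ E] [CompleteSpace E]

lemma eq_exp_smul_of_hasDerivAt {H : E →L[ℝ] E} {w : ℝ → E}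
    (hw : ∀ t, HasDerivAt w (H (w t)) t) (t : ℝ) :
    w t = NormedSpace.exp (t • H) (w 0) := by
  have hv : ∀ t, HasDerivAt (fun t : ℝ => NormedSpace.exp (t • H) (w 0))
      (H (NormedSpace.exp (t • H) (w 0))) t := fun t =>
    ((hasDerivAt_exp_smul_const' H t).clm_apply (hasDerivAt_const t (w 0))).congr_deriv (by simp)
  have h := ODE_solution_unique_univ (v := fun _ => H) (s := fun _ => Set.univ) (t₀ := 0)
    (fun _ => H.lipschitz.lipschitzOnWith) (fun t => ⟨hw t, trivial⟩)
    (fun t => ⟨hv t, trivial⟩) (by simp)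
  exact congrFun h t

lemma exp_smul_eq_exp_neg_smul (H : E →L[ℝ] E) {c : ℝ} (hc : c ≠ 0) (t : ℝ) :
    NormedSpace.exp (t • H) =
      Real.exp (-(c * t)) • NormedSpace.exp ((c * t) • (1 + c⁻¹ • H)) := by
  have h1 : t • H = (c * t) • (1 + c⁻¹ • H) + -((c * t) • (1 : E →L[ℝ] E)) := by
    rw [smul_add, smul_smul, mul_comm c t, mul_assoc, mul_inv_cancel₀ hc, mul_one]
    abel
  have h2 : NormedSpace.exp (-((c * t) • (1 : E →L[ℝ] E))) =
      Real.exp (-(c * t)) • (1 : E →L[ℝ] E) := by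
    rw [← neg_smul, ← Algebra.algebraMap_eq_smul_one, ← NormedSpace.algebraMap_exp_comm,
      Algebra.algebraMap_eq_smul_one, Real.exp_eq_exp_ℝ]
  let : NormedAlgebra ℚ (E →L[ℝ] E) := .restrictScalars ℚ ℝ _
  rw [h1, NormedSpace.exp_add_of_commute, h2, mul_smul_comm, mul_one]
  exact ((Commute.one_right _).smul_right _).neg_right

lemma hasSum_semigroup_apply {H : E →L[ℝ] E} {w : ℝ → E}
    (hw : ∀ t, HasDerivAt w (H (w t)) t) {c : ℝ} (hc : c ≠ 0) (t : ℝ) :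
    HasSum (fun n : ℕ => (Real.exp (-(c * t)) * ((c * t) ^ n / n.factorial)) •
      ((1 + c⁻¹ • H) ^ n) (w 0)) (w t) := by
  rw [eq_exp_smul_of_hasDerivAt hw t, exp_smul_eq_exp_neg_smul H hc]
  have h := ((ContinuousLinearMap.apply ℝ E (w 0)).hasSum
    (NormedSpace.exp_series_hasSum_exp' (𝕂 := ℝ) ((c * t) • (1 + c⁻¹ • H)))).const_smul
      (Real.exp (-(c * t)))
  simp only [ContinuousLinearMap.apply_apply, smul_pow, _root_.smul_apply] at h
  rw [_root_.smul_apply]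
  convert h using 2 with n
  rw [smul_smul, smul_smul]
  congr 1
  rw [div_eq_mul_inv]
  ring

end Semigroup

lemma one_add_smul_pow_apply {d : ℕ} {κ ρ γ : ℝ}
    {H : ((Fin d → ℤ) × (Fin d → ℤ) →ᵇ ℝ) →L[ℝ] ((Fin d → ℤ) × (Fin d → ℤ) →ᵇ ℝ)}
    (hH : ∀ (f : (Fin d → ℤ) × (Fin d → ℤ) →ᵇ ℝ) (q : (Fin d → ℤ) × (Fin d → ℤ)),
      H f q = κ * (∑ i : Fin d,
          ((f (q.1 + Pi.single i 1, q.2) - f q) + (f (q.1 - Pi.single i 1, q.2) - f q)))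
        + ρ * (∑ i : Fin d,
          ((f (q.1, q.2 + Pi.single i 1) - f q) + (f (q.1, q.2 - Pi.single i 1) - f q)))
        + γ * (if q.1 = q.2 then f q else 0))
    {g : (Fin d → ℤ) × (Fin d → ℤ) →ᵇ ℝ}
    (hg : ∀ q : (Fin d → ℤ) × (Fin d → ℤ), g q = if q.2 = 0 then 1 else 0)
    (c : ℝ) (n : ℕ) (q : (Fin d → ℤ) × (Fin d → ℤ)) :
    ((1 + c⁻¹ • H) ^ n) g q =
      (trapWalk d (κ / c) (ρ / c) (-γ / c) ^ n) (Pi.single 0 1 ∘ Prod.snd) q := by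
  induction n generalizing q with
  | zero =>
    rw [pow_zero, pow_zero, one_apply_eq_self, Module.End.one_apply, hg,
      Function.comp_apply, Pi.single_apply]
  | succ n ih =>
    rw [pow_succ', pow_succ', mul_apply_eq_comp, Module.End.mul_apply, ← funext ih]
    set u := ((1 + c⁻¹ • H) ^ n) g
    have h : (1 + c⁻¹ • H) u q = u q + c⁻¹ * H u q := rfl
    rw [h, hH, trapWalk_apply, latticeLaplacian_apply, latticeLaplacian_apply]
    simp only [div_eq_mul_inv]
    ring

/-- For every `d ≥ 2` and every `x ∈ ℤ^d`, the expected mass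
`m_x(t) = Σ_y (exp(tĤ)g)(x,y)` of the parabolic Anderson model with homogeneous
initial condition and a moving trap, where `Ĥ = Â + γV̂` on `ℓ^∞(ℤ^d × ℤ^d)` with
`V̂` multiplication by the indicator of the diagonal and `g(x,y) = 1_{y=0}`,
satisfies `lim_{t→∞} m_x(t) = 1`.
The semigroup `t ↦ exp(tĤ) g` is encoded as the (unique, since `Ĥ` is bounded)
solution `w : ℝ → ℓ^∞(ℤ^d × ℤ^d)` of `w' = Ĥ w`, `w 0 = g`; the convergent series
defining `m_x(t)` is encoded by `HasSum`. -/
theorem moving_trap_homogeneous_dim_ge_two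
    (d : ℕ) (hd : 2 ≤ d)
    (κ ρ γ : ℝ) (hκ : 0 < κ) (hρ : 0 < ρ) (hγ : γ < 0)
    (H : ((Fin d → ℤ) × (Fin d → ℤ) →ᵇ ℝ) →L[ℝ] ((Fin d → ℤ) × (Fin d → ℤ) →ᵇ ℝ))
    (hH : ∀ (f : (Fin d → ℤ) × (Fin d → ℤ) →ᵇ ℝ) (q : (Fin d → ℤ) × (Fin d → ℤ)),
      H f q = κ * (∑ i : Fin d,
          ((f (q.1 + Pi.single i 1, q.2) - f q) + (f (q.1 - Pi.single i 1, q.2) - f q)))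
        + ρ * (∑ i : Fin d,
          ((f (q.1, q.2 + Pi.single i 1) - f q) + (f (q.1, q.2 - Pi.single i 1) - f q)))
        + γ * (if q.1 = q.2 then f q else 0))
    (g : (Fin d → ℤ) × (Fin d → ℤ) →ᵇ ℝ)
    (hg : ∀ q : (Fin d → ℤ) × (Fin d → ℤ), g q = if q.2 = 0 then 1 else 0)
    (w : ℝ → ((Fin d → ℤ) × (Fin d → ℤ) →ᵇ ℝ)) (hw0 : w 0 = g)
    (hw : ∀ t : ℝ, HasDerivAt w (H (w t)) t)
    (m : (Fin d → ℤ) → ℝ → ℝ)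
    (hm : ∀ (x : Fin d → ℤ) (t : ℝ), HasSum (fun y : Fin d → ℤ => w t (x, y)) (m x t))
    (x : Fin d → ℤ) :
    Tendsto (fun t : ℝ => m x t) atTop (𝓝 1) := by
  set c : ℝ := 8 * d * (κ + ρ) - γ with hcdef
  have hdκ : 0 ≤ d * (κ + ρ) := by positivity
  have hc : 0 < c := by linarith
  set a := κ / c
  set b := ρ / c
  set δ := -γ / c
  have ha : 0 < a := div_pos hκ hc
  have hb : 0 < b := div_pos hρ hc
  have hδ : 0 < δ := div_pos (neg_pos.2 hγ) hc
  have h8 : 8 * d * (a + b) + δ = 1 := by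
    rw [← div_self hc.ne', ← add_div, ← mul_div_assoc, ← add_div, hcdef, sub_eq_add_neg]
  have hdab : 0 ≤ d * (a + b) := by positivity
  have h2 : 2 * d * (a + b) + δ ≤ 1 := by linarith
  have hB : ∀ n q, ((1 + c⁻¹ • H) ^ n) g q =
      (trapWalk d a b δ ^ n) (Pi.single 0 1 ∘ Prod.snd) q := one_add_smul_pow_apply hH hg c
  have key : ∀ t, 0 ≤ t → HasSum (fun n : ℕ => Real.exp (-(c * t)) * ((c * t) ^ n / n.factorial) *
      trapMass d a b δ n x) (m x t) := fun t ht => by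
    have hct : 0 ≤ c * t := mul_nonneg hc.le ht
    set K : ℕ → ℝ := fun n => Real.exp (-(c * t)) * ((c * t) ^ n / n.factorial)
    have hK : ∀ n, 0 ≤ K n := fun n => by positivity
    set φ : (Fin d → ℤ) → ℕ → ℝ := fun y n =>
      (trapWalk d a b δ ^ n) (Pi.single 0 1 ∘ Prod.snd) (x, y)
    have hφ : ∀ y n, 0 ≤ φ y n := fun y n =>
      trapWalk_pow_nonneg ha.le hb.le hδ.le h2 single_comp_snd_nonneg n (x, y)
    have hmass : ∀ n, HasSum (fun y => φ y n) (trapMass d a b δ n x) := fun n =>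
      hasSum_trapMass n x
    have hsemi : ∀ y, HasSum (fun n => K n * φ y n) (w t (x, y)) := fun y => by
      have h := (BoundedContinuousFunction.evalCLM ℝ (x, y)).hasSum
        (hasSum_semigroup_apply hw hc.ne' t)
      simpa only [BoundedContinuousFunction.evalCLM_apply, BoundedContinuousFunction.smul_apply,
        smul_eq_mul, hw0, hB] using h
    exact hasSum_comm_of_nonneg (fun y n => mul_nonneg (hK n) (hφ y n)) hsemi
      (fun n => (hmass n).mul_left (K n)) (hm x t)
  have hlim := tendsto_poisson_average (F := fun s => m x (s / c))
    (fun n => trapMass_nonneg ha.le hb.le hδ.le h2 n x)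
    (fun n => trapMass_le_one ha.le hb.le hδ.le h2 n x)
    (tendsto_trapMass hd ha hb hδ h8.le x)
    (fun s hs => by simpa only [mul_div_cancel₀ s hc.ne'] using key (s / c) (by positivity))
  refine (hlim.comp (tendsto_id.const_mul_atTop hc)).congr fun t => ?_
  simp [hc.ne']
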